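/- arXiv:1911.06889 — 10 statements merged into one kernel-verified Lean document; each statement's English description precedes it below -/
import Mathlib

section
/- For every n ≥ 1, every permutation σ of [n], and every c : {0,1,…,n} → {0,1}, the function f_σ^c is submodular: for all X, Y ⊆ [n], f_σ^c(X ∪ Y) + f_σ^c(X ∩ Y) ≤ f_σ^c(X) + f_σ^c(Y). -/
open scoped Classical

/-- The important set `R_i = {σ(1), …, σ(i)}`, for `0 ≤ i ≤ n`. -/
noncomputable def impSet (n : ℕ) (σ : Equiv.Perm (Fin n)) (i : ℕ) : Finset (Fin n) :=
  Finset.univ.filter (fun x => (σ.symm x : ℕ) < i)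

/-- `jS n σ S` is the largest `j ≤ n` with `R_j ⊆ S` (well-defined since `R_0 = ∅`). -/
noncomputable def jS (n : ℕ) (σ : Equiv.Perm (Fin n)) (S : Finset (Fin n)) : ℕ :=
  Nat.findGreatest (fun j => impSet n σ j ⊆ S) n

/-- The function `f_σ^c`: equal to `-c_i` on the important set `R_i`
(note `|R_i| = i`), and `(|S| - j(S)) * (n + 2 - j(S))` on unimportant sets. -/
noncomputable def fsc (n : ℕ) (σ : Equiv.Perm (Fin n)) (c : ℕ → ℝ)
    (S : Finset (Fin n)) : ℝ :=
  if ∃ i ≤ n, S = impSet n σ i then -(c S.card)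
  else ((S.card : ℝ) - (jS n σ S : ℕ)) * ((n : ℝ) + 2 - (jS n σ S : ℕ))

section ImportantSets

variable {n : ℕ} {σ : Equiv.Perm (Fin n)}

theorem mem_impSet {i : ℕ} {x : Fin n} : x ∈ impSet n σ i ↔ (σ.symm x : ℕ) < i := by
  simp [impSet]

theorem impSet_mono {i j : ℕ} (h : i ≤ j) : impSet n σ i ⊆ impSet n σ j := fun _ hx =>
  mem_impSet.2 ((mem_impSet.1 hx).trans_le h)

theorem card_impSet {i : ℕ} (hi : i ≤ n) : (impSet n σ i).card = i := by
  have h : impSet n σ i =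
      (Finset.univ.filter (fun y : Fin n => (y : ℕ) < i)).map σ.toEmbedding := by
    ext x
    simp [impSet, Finset.mem_map_equiv]
  rw [h, Finset.card_map, Fin.card_filter_val_lt, min_eq_right hi]

theorem jS_le (S : Finset (Fin n)) : jS n σ S ≤ n := Nat.findGreatest_le n

theorem impSet_jS_subset (S : Finset (Fin n)) : impSet n σ (jS n σ S) ⊆ S :=
  Nat.findGreatest_spec (P := fun j => impSet n σ j ⊆ S) (Nat.zero_le n) (by simp [impSet])

theorem le_jS {S : Finset (Fin n)} {i : ℕ} (hi : i ≤ n) (h : impSet n σ i ⊆ S) : i ≤ jS n σ S :=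
  Nat.le_findGreatest (P := fun j => impSet n σ j ⊆ S) hi h

theorem jS_mono {S T : Finset (Fin n)} (h : S ⊆ T) : jS n σ S ≤ jS n σ T :=
  le_jS (jS_le S) ((impSet_jS_subset S).trans h)

theorem jS_impSet {i : ℕ} (hi : i ≤ n) : jS n σ (impSet n σ i) = i := by
  refine le_antisymm ?_ (le_jS hi subset_rfl)
  have h := Finset.card_le_card (impSet_jS_subset (σ := σ) (impSet n σ i))
  rwa [card_impSet (jS_le _), card_impSet hi] at h

theorem jS_inter (X Y : Finset (Fin n)) : jS n σ (X ∩ Y) = min (jS n σ X) (jS n σ Y) := by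
  refine le_antisymm (le_min (jS_mono Finset.inter_subset_left)
    (jS_mono Finset.inter_subset_right)) (le_jS ((min_le_left _ _).trans (jS_le X)) ?_)
  exact Finset.subset_inter ((impSet_mono (min_le_left _ _)).trans (impSet_jS_subset X))
    ((impSet_mono (min_le_right _ _)).trans (impSet_jS_subset Y))

theorem jS_le_card (S : Finset (Fin n)) : jS n σ S ≤ S.card := by
  simpa only [card_impSet (jS_le S)] using Finset.card_le_card (impSet_jS_subset (σ := σ) S)

theorem notMem_of_val_symm_eq_jS {S : Finset (Fin n)} {x : Fin n}
    (hx : (σ.symm x : ℕ) = jS n σ S) : x ∉ S := by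
  intro hxS
  have h : jS n σ S + 1 ≤ jS n σ S := by
    refine le_jS (hx ▸ (σ.symm x).isLt) fun y hy => ?_
    rcases (Nat.lt_succ_iff.1 (mem_impSet.1 hy)).lt_or_eq with hlt | heq
    · exact impSet_jS_subset S (mem_impSet.2 hlt)
    · rwa [σ.symm.injective (Fin.ext (heq.trans hx.symm))]
  omega

theorem jS_union_of_eq {X Y : Finset (Fin n)} (h : jS n σ X = jS n σ Y) :
    jS n σ (X ∪ Y) = jS n σ X := by
  refine le_antisymm ?_ (jS_mono Finset.subset_union_left)
  by_contra! hlt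
  have hn : jS n σ X < n := hlt.trans_le (jS_le _)
  have hx : (σ.symm (σ ⟨jS n σ X, hn⟩) : ℕ) = jS n σ X := by simp
  have hmem := impSet_jS_subset (X ∪ Y) (mem_impSet.2 (hx.trans_lt hlt))
  rcases Finset.mem_union.1 hmem with hX | hY
  · exact notMem_of_val_symm_eq_jS hx hX
  · exact notMem_of_val_symm_eq_jS (hx.trans h) hY

/-- The amount by which `fsc` lies below the product formula: `c_i` at `R_i`, and `0` elsewhere. -/
noncomputable def impDrop (n : ℕ) (σ : Equiv.Perm (Fin n)) (c : ℕ → ℝ)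
    (S : Finset (Fin n)) : ℝ :=
  if S = impSet n σ (jS n σ S) then c (jS n σ S) else 0

theorem fsc_eq_sub_impDrop (c : ℕ → ℝ) (S : Finset (Fin n)) :
    fsc n σ c S =
      ((S.card : ℝ) - jS n σ S) * ((n : ℝ) + 2 - jS n σ S) - impDrop n σ c S := by
  unfold fsc impDrop
  by_cases h : S = impSet n σ (jS n σ S)
  · have hcard : S.card = jS n σ S := by
      simpa only [← h] using card_impSet (σ := σ) (jS_le (σ := σ) S)
    rw [if_pos ⟨_, jS_le S, h⟩, if_pos h, hcard]
    ring
  · rw [if_neg h, if_neg, sub_zero]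
    rintro ⟨i, hi, rfl⟩
    exact h (by rw [jS_impSet hi])

theorem impDrop_mem_Icc {c : ℕ → ℝ} (hc : ∀ i ≤ n, c i = 0 ∨ c i = 1) (S : Finset (Fin n)) :
    impDrop n σ c S ∈ Set.Icc (0 : ℝ) 1 := by
  unfold impDrop
  split_ifs
  · rcases hc _ (jS_le (σ := σ) S) with h | h <;> simp [h]
  · simp

theorem impDrop_eq_zero {c : ℕ → ℝ} {X Y : Finset (Fin n)} (h : jS n σ X ≤ jS n σ Y)
    (hXY : ¬ X ⊆ Y) : impDrop n σ c X = 0 :=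
  if_neg fun hX => hXY (hX.subset.trans ((impSet_mono h).trans (impSet_jS_subset Y)))

theorem fsc_union_add_inter_le {c : ℕ → ℝ} (hc : ∀ i ≤ n, c i = 0 ∨ c i = 1)
    {X Y : Finset (Fin n)} (h : jS n σ X ≤ jS n σ Y) :
    fsc n σ c (X ∪ Y) + fsc n σ c (X ∩ Y) ≤ fsc n σ c X + fsc n σ c Y := by
  by_cases hXY : X ⊆ Y
  · rw [Finset.union_eq_right.2 hXY, Finset.inter_eq_left.2 hXY, add_comm]
  by_cases hYX : Y ⊆ X
  · rw [Finset.union_eq_left.2 hYX, Finset.inter_eq_right.2 hYX]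
  have hcard : ((X ∪ Y).card : ℝ) + (X ∩ Y).card = X.card + Y.card := by
    exact_mod_cast Finset.card_union_add_card_inter X Y
  have hU := (impDrop_mem_Icc (σ := σ) hc (X ∪ Y)).1
  have hI := (impDrop_mem_Icc (σ := σ) hc (X ∩ Y)).1
  have hY := (impDrop_mem_Icc (σ := σ) hc Y).2
  simp only [fsc_eq_sub_impDrop]
  rw [impDrop_eq_zero h hXY, jS_inter, min_eq_left h]
  rcases h.lt_or_eq with hlt | heq
  · have hk : (jS n σ Y : ℝ) ≤ jS n σ (X ∪ Y) := by
      exact_mod_cast jS_mono Finset.subset_union_right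
    have hkn : (jS n σ (X ∪ Y) : ℝ) ≤ n := by exact_mod_cast jS_le _
    have hab : (jS n σ X : ℝ) + 1 ≤ jS n σ Y := by exact_mod_cast hlt
    have hy : (jS n σ Y : ℝ) ≤ Y.card := by exact_mod_cast jS_le_card Y
    have hw : ((X ∩ Y).card : ℝ) + 1 ≤ X.card := by
      exact_mod_cast Finset.card_lt_card
        ⟨Finset.inter_subset_left, fun hs => hXY (hs.trans Finset.inter_subset_right)⟩
    have hUcard : ((X ∪ Y).card : ℝ) = X.card + Y.card - (X ∩ Y).card := by linarith
    rw [hUcard]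
    generalize (jS n σ (X ∪ Y) : ℝ) = k at *
    generalize (jS n σ X : ℝ) = a at *
    generalize (jS n σ Y : ℝ) = b at *
    have h₁ : 1 ≤ ((X.card : ℝ) - (X ∩ Y).card) * (k - a) := by nlinarith
    have h₂ : 0 ≤ ((Y.card : ℝ) - b) * (k - b) :=
      mul_nonneg (by linarith) (by linarith)
    have h₃ : 0 ≤ (k - b) * ((n : ℝ) + 2 - k) := mul_nonneg (by linarith) (by linarith)
    linear_combination h₁ + h₂ + h₃ + hU + hI + hY
  · rw [impDrop_eq_zero heq.ge hYX, jS_union_of_eq heq, ← heq]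
    linear_combination ((n : ℝ) + 2 - jS n σ X) * hcard + hU + hI

end ImportantSets

/-- For every `n ≥ 1`, permutation `σ` of `[n]` and `c : {0,…,n} → {0,1}`,
the function `f_σ^c` is submodular. -/
theorem stmt_0 (n : ℕ) (hn : 1 ≤ n) (σ : Equiv.Perm (Fin n)) (c : ℕ → ℝ)
    (hc : ∀ i ≤ n, c i = 0 ∨ c i = 1) :
    ∀ X Y : Finset (Fin n),
      fsc n σ c (X ∪ Y) + fsc n σ c (X ∩ Y) ≤ fsc n σ c X + fsc n σ c Y := by
  intro X Y
  rcases le_total (jS n σ X) (jS n σ Y) with h | h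
  · exact fsc_union_add_inter_le hc h
  · rw [Finset.union_comm, Finset.inter_comm, add_comm (fsc n σ c X)]
    exact fsc_union_add_inter_le hc h
end

section
/- For every n ≥ 2, every permutation σ of [n], every c : {0,1,…,n} → {0,1}, and every i ∈ [n]: if σ(n) = i then f_σ^c([n] \ {i}) = −c_{n−1} ≤ 0, and if σ(n) ≠ i then f_σ^c([n] \ {i}) = (n − σ^{-1}(i))·(n + 3 − σ^{-1}(i)) > 0. In particular, f_σ^c([n] \ {i}) ≤ 0 if and only if σ(n) = i, and when σ(n) ≠ i the value f_σ^c([n] \ {i}) determines σ^{-1}(i). -/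
open scoped Classical

/-- `R_j` avoids `i` exactly when `j` is at most the (0-indexed) position of `i`. -/
theorem impSet_subset_compl_singleton_iff (n : ℕ) (σ : Equiv.Perm (Fin n)) (i : Fin n) (j : ℕ) :
    impSet n σ j ⊆ {i}ᶜ ↔ j ≤ (σ.symm i : ℕ) := by
  simp [Finset.subset_compl_singleton, impSet]

theorem jS_compl_singleton (n : ℕ) (σ : Equiv.Perm (Fin n)) (i : Fin n) :
    jS n σ {i}ᶜ = (σ.symm i : ℕ) := by
  simp only [jS, impSet_subset_compl_singleton_iff]
  rw [Nat.findGreatest_eq_iff]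
  exact ⟨(σ.symm i).isLt.le, fun _ => le_rfl, fun _ h _ => not_le.mpr h⟩

theorem exists_compl_singleton_eq_impSet_iff (n : ℕ) (σ : Equiv.Perm (Fin n)) (i : Fin n) :
    (∃ k ≤ n, ({i}ᶜ : Finset (Fin n)) = impSet n σ k) ↔ (σ.symm i : ℕ) = n - 1 := by
  have hlt := (σ.symm i).isLt
  constructor
  · rintro ⟨k, -, hk⟩
    by_contra hne
    have hle : k ≤ (σ.symm i : ℕ) := (impSet_subset_compl_singleton_iff n σ i k).mp hk.ge
    have hlast : σ ⟨n - 1, by omega⟩ ∈ ({i}ᶜ : Finset (Fin n)) := by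
      rw [Finset.mem_compl, Finset.mem_singleton]
      intro heq
      exact hne (by rw [← σ.eq_symm_apply.mpr heq])
    rw [hk] at hlast
    simp only [impSet, Finset.mem_filter, Equiv.symm_apply_apply] at hlast
    omega
  · intro h
    refine ⟨n - 1, by omega, ?_⟩
    ext x
    have hx := (σ.symm x).isLt
    simp only [impSet, Finset.mem_compl, Finset.mem_singleton, Finset.mem_filter,
      Finset.mem_univ, true_and]
    rw [← σ.symm.injective.eq_iff, Fin.ext_iff]
    omega

theorem fsc_compl_singleton_of_last (n : ℕ) (σ : Equiv.Perm (Fin n)) (c : ℕ → ℝ) (i : Fin n)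
    (h : (σ.symm i : ℕ) = n - 1) : fsc n σ c {i}ᶜ = -(c (n - 1)) := by
  rw [fsc, if_pos ((exists_compl_singleton_eq_impSet_iff n σ i).mpr h), Finset.card_compl,
    Finset.card_singleton, Fintype.card_fin]

theorem fsc_compl_singleton_of_not_last (n : ℕ) (σ : Equiv.Perm (Fin n)) (c : ℕ → ℝ) (i : Fin n)
    (h : (σ.symm i : ℕ) ≠ n - 1) :
    fsc n σ c {i}ᶜ
      = ((n : ℝ) - 1 - ((σ.symm i : ℕ) : ℝ)) * ((n : ℝ) + 2 - ((σ.symm i : ℕ) : ℝ)) := by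
  have hn : 1 ≤ n := i.pos
  rw [fsc, if_neg (mt (exists_compl_singleton_eq_impSet_iff n σ i).mp h), Finset.card_compl,
    Finset.card_singleton, Fintype.card_fin, jS_compl_singleton, Nat.cast_sub hn, Nat.cast_one]

/-- Evaluation of `f_σ^c` on the sets `[n] \ {i}`.  Here `Fin n` is 0-indexed, so
the paper's `σ(n) = i` reads `(σ.symm i : ℕ) = n - 1`, and the paper's `σ⁻¹(i)`
equals `(σ.symm i : ℕ) + 1`, so `n - σ⁻¹(i) = n - 1 - (σ.symm i : ℕ)` and
`n + 3 - σ⁻¹(i) = n + 2 - (σ.symm i : ℕ)`. -/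
theorem stmt_3 (n : ℕ) (hn : 2 ≤ n) (σ : Equiv.Perm (Fin n)) (c : ℕ → ℝ)
    (hc : ∀ i ≤ n, c i = 0 ∨ c i = 1) (i : Fin n) :
    ((σ.symm i : ℕ) = n - 1 →
      fsc n σ c ({i}ᶜ) = -(c (n - 1)) ∧ fsc n σ c ({i}ᶜ) ≤ 0) ∧
    ((σ.symm i : ℕ) ≠ n - 1 →
      fsc n σ c ({i}ᶜ)
        = ((n : ℝ) - 1 - ((σ.symm i : ℕ) : ℝ)) * ((n : ℝ) + 2 - ((σ.symm i : ℕ) : ℝ)) ∧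
      0 < fsc n σ c ({i}ᶜ)) ∧
    (fsc n σ c ({i}ᶜ) ≤ 0 ↔ (σ.symm i : ℕ) = n - 1) ∧
    (∀ i' : Fin n, (σ.symm i : ℕ) ≠ n - 1 → (σ.symm i' : ℕ) ≠ n - 1 →
      fsc n σ c ({i}ᶜ) = fsc n σ c ({i'}ᶜ) → σ.symm i = σ.symm i') := by
  have hbound : ∀ k : Fin n, (σ.symm k : ℕ) ≠ n - 1 → ((σ.symm k : ℕ) : ℝ) + 2 ≤ n := by
    intro k hk
    have := (σ.symm k).isLt
    exact_mod_cast (by omega : (σ.symm k : ℕ) + 2 ≤ n)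
  have hlast : (σ.symm i : ℕ) = n - 1 → fsc n σ c ({i}ᶜ) ≤ 0 := by
    intro h
    rw [fsc_compl_singleton_of_last n σ c i h]
    rcases hc (n - 1) (Nat.sub_le n 1) with h0 | h1
    · simp [h0]
    · simp [h1]
  have hpos : (σ.symm i : ℕ) ≠ n - 1 → 0 < fsc n σ c ({i}ᶜ) := by
    intro h
    rw [fsc_compl_singleton_of_not_last n σ c i h]
    have := hbound i h
    apply mul_pos <;> linarith
  refine ⟨fun h => ⟨fsc_compl_singleton_of_last n σ c i h, hlast h⟩,
    fun h => ⟨fsc_compl_singleton_of_not_last n σ c i h, hpos h⟩,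
    ⟨fun h => by_contra fun hne => (hpos hne).not_ge h, hlast⟩, ?_⟩
  intro i' h h' heq
  rw [fsc_compl_singleton_of_not_last n σ c i h,
    fsc_compl_singleton_of_not_last n σ c i' h'] at heq
  have hb := hbound i h
  have hb' := hbound i' h'
  have hfactor : (((σ.symm i : ℕ) : ℝ) - ((σ.symm i' : ℕ) : ℝ))
      * (2 * (n : ℝ) + 1 - ((σ.symm i : ℕ) : ℝ) - ((σ.symm i' : ℕ) : ℝ)) = 0 := by
    linear_combination -heq
  rcases mul_eq_zero.mp hfactor with h0 | h0
  · exact Fin.ext (by exact_mod_cast sub_eq_zero.mp h0)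
  · linarith
end

section
/- Let f be a weight-based function with nonnegative weights w and active-set map h, and let M_f be the set of subsets of [n] minimizing f. Then for all S, T ∈ M_f, the indicator vectors satisfy v^{S ∪ T} = v^S + v^T − v^{S ∩ T} (as vectors in ℝ^m). -/
open scoped Classical

/-- The weight-based function `f(S) = Σ_{i ∈ h(S)} w_i`. -/
noncomputable def wbf (n m : ℕ) (h : Finset (Fin n) → Finset (Fin m))
    (w : Fin m → ℝ) (S : Finset (Fin n)) : ℝ :=
  ∑ i ∈ h S, w i

/-- The indicator vector `v^S ∈ ℝ^m`: coordinate `i` is `1` iff `i ∈ h(S)` and `w_i > 0`. -/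
noncomputable def vind (n m : ℕ) (h : Finset (Fin n) → Finset (Fin m))
    (w : Fin m → ℝ) (S : Finset (Fin n)) : Fin m → ℝ :=
  fun i => if i ∈ h S ∧ 0 < w i then 1 else 0

/-- `S` is a minimizer of the weight-based function given by `h, w`. -/
def isMinW (n m : ℕ) (h : Finset (Fin n) → Finset (Fin m)) (w : Fin m → ℝ)
    (S : Finset (Fin n)) : Prop :=
  ∀ T : Finset (Fin n), wbf n m h w S ≤ wbf n m h w T

/-- The weight-based function as a sum over all hyperedges. -/
theorem wbf_eq_sum_ite (n m : ℕ) (h : Finset (Fin n) → Finset (Fin m)) (w : Fin m → ℝ)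
    (S : Finset (Fin n)) :
    wbf n m h w S = ∑ i, w i * (if i ∈ h S then 1 else 0) := by
  simp [wbf]

/-- A multiset containment between sums of finsets, read off at one element. -/
theorem ite_mem_add_le_of_val_add_le {α : Type*} [DecidableEq α] {A B C D : Finset α}
    (hle : A.val + B.val ≤ C.val + D.val) (i : α) :
    (if i ∈ A then (1 : ℝ) else 0) + (if i ∈ B then 1 else 0) ≤
      (if i ∈ C then 1 else 0) + (if i ∈ D then 1 else 0) := by
  have hcount := Multiset.count_le_of_le i hle
  simp only [Multiset.count_add, Multiset.count_eq_of_nodup (Finset.nodup _),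
    Finset.mem_val] at hcount
  exact_mod_cast hcount

/-- For minimizers `S, T` of a weight-based function, the indicator vectors
satisfy `v^{S ∪ T} = v^S + v^T - v^{S ∩ T}`. -/
theorem stmt_6 (n m : ℕ) (h : Finset (Fin n) → Finset (Fin m))
    (hwb : ∀ S T : Finset (Fin n),
      (h (S ∩ T)).val + (h (S ∪ T)).val ≤ (h S).val + (h T).val)
    (w : Fin m → ℝ) (hw : ∀ i, 0 ≤ w i)
    (S T : Finset (Fin n)) (hS : isMinW n m h w S) (hT : isMinW n m h w T) :
    vind n m h w (S ∪ T) = vind n m h w S + vind n m h w T - vind n m h w (S ∩ T) := by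
  have hnonneg : ∀ i ∈ Finset.univ, 0 ≤ w i * (((if i ∈ h S then (1 : ℝ) else 0) +
      (if i ∈ h T then 1 else 0)) -
      ((if i ∈ h (S ∩ T) then 1 else 0) + (if i ∈ h (S ∪ T) then 1 else 0))) := fun i _ =>
    mul_nonneg (hw i) (sub_nonneg.2 (ite_mem_add_le_of_val_add_le (hwb S T) i))
  have hsum : ∑ i, w i * (((if i ∈ h S then (1 : ℝ) else 0) + (if i ∈ h T then 1 else 0)) -
      ((if i ∈ h (S ∩ T) then 1 else 0) + (if i ∈ h (S ∪ T) then 1 else 0))) = 0 := by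
    refine le_antisymm ?_ (Finset.sum_nonneg hnonneg)
    have hinter := hS (S ∩ T)
    have hunion := hT (S ∪ T)
    simp only [wbf_eq_sum_ite] at hinter hunion
    simp only [mul_sub, mul_add, Finset.sum_sub_distrib, Finset.sum_add_distrib]
    linarith
  funext i
  have hi := (Finset.sum_eq_zero_iff_of_nonneg hnonneg).1 hsum i (Finset.mem_univ i)
  by_cases hpos : 0 < w i
  · have hzero := (mul_eq_zero.1 hi).resolve_left hpos.ne'
    simp only [vind, Pi.add_apply, Pi.sub_apply, hpos, and_true]
    linarith
  · simp [vind, hpos]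
end

section
/- Let f be a weight-based function with nonnegative weights, let M_f be its set of minimizers, and let B consist of ∅ (if ∅ ∈ M_f) together with the sets S_i = ⋂{S ∈ M_f : i ∈ S} for each i ∈ [n] contained in some minimizer. Then for every S ∈ M_f, the indicator vector v^S lies in the linear span of {v^T : T ∈ B}. -/
open scoped Classical

/-- `baseSetW n m h w i` is the intersection of all minimizers of the
weight-based function containing `i`. -/
noncomputable def baseSetW (n m : ℕ) (h : Finset (Fin n) → Finset (Fin m))
    (w : Fin m → ℝ) (i : Fin n) : Finset (Fin n) :=
  Finset.univ.filter (fun x => ∀ U : Finset (Fin n), isMinW n m h w U → i ∈ U → x ∈ U)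

section

variable {n m : ℕ} {h : Finset (Fin n) → Finset (Fin m)} {w : Fin m → ℝ}

theorem wbf_eq_sum_mul_vind (hw : ∀ i, 0 ≤ w i) (S : Finset (Fin n)) :
    wbf n m h w S = ∑ i, w i * vind n m h w S i := by
  have key : ∀ i, w i * vind n m h w S i = if i ∈ h S then w i else 0 := by
    intro i
    rcases (hw i).lt_or_eq with hi | hi
    · simp [vind, hi]
    · simp [← hi]
  simp only [key, wbf]
  rw [Finset.sum_ite_mem, Finset.univ_inter]

theorem vind_inter_add_union_le
    (hwb : ∀ S T : Finset (Fin n),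
      (h (S ∩ T)).val + (h (S ∪ T)).val ≤ (h S).val + (h T).val)
    (S T : Finset (Fin n)) (i : Fin m) :
    vind n m h w (S ∩ T) i + vind n m h w (S ∪ T) i ≤ vind n m h w S i + vind n m h w T i := by
  by_cases hi : 0 < w i
  · have hc := Multiset.count_le_of_le i (hwb S T)
    simp only [Multiset.count_add, Multiset.count_eq_of_nodup (Finset.nodup _),
      Finset.mem_val] at hc
    simp only [vind, hi, and_true]
    exact_mod_cast hc
  · simp [vind, hi]

theorem wbf_inter_add_union_le
    (hwb : ∀ S T : Finset (Fin n),
      (h (S ∩ T)).val + (h (S ∪ T)).val ≤ (h S).val + (h T).val)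
    (hw : ∀ i, 0 ≤ w i) (S T : Finset (Fin n)) :
    wbf n m h w (S ∩ T) + wbf n m h w (S ∪ T) ≤ wbf n m h w S + wbf n m h w T := by
  simp only [wbf_eq_sum_mul_vind hw, ← Finset.sum_add_distrib, ← mul_add]
  exact Finset.sum_le_sum fun i _ =>
    mul_le_mul_of_nonneg_left (vind_inter_add_union_le hwb S T i) (hw i)

theorem isMinW.inter
    (hwb : ∀ S T : Finset (Fin n),
      (h (S ∩ T)).val + (h (S ∪ T)).val ≤ (h S).val + (h T).val)
    (hw : ∀ i, 0 ≤ w i) {S T : Finset (Fin n)}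
    (hS : isMinW n m h w S) (hT : isMinW n m h w T) : isMinW n m h w (S ∩ T) := by
  intro U
  linarith [wbf_inter_add_union_le hwb hw S T, hS U, hT (S ∪ T)]

theorem isMinW.union
    (hwb : ∀ S T : Finset (Fin n),
      (h (S ∩ T)).val + (h (S ∪ T)).val ≤ (h S).val + (h T).val)
    (hw : ∀ i, 0 ≤ w i) {S T : Finset (Fin n)}
    (hS : isMinW n m h w S) (hT : isMinW n m h w T) : isMinW n m h w (S ∪ T) := by
  intro U
  linarith [wbf_inter_add_union_le hwb hw S T, hS U, hT (S ∩ T)]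

/-- Indicator vectors are modular on the lattice of minimizers. -/
theorem vind_inter_add_union
    (hwb : ∀ S T : Finset (Fin n),
      (h (S ∩ T)).val + (h (S ∪ T)).val ≤ (h S).val + (h T).val)
    (hw : ∀ i, 0 ≤ w i) {S T : Finset (Fin n)}
    (hS : isMinW n m h w S) (hT : isMinW n m h w T) :
    vind n m h w (S ∩ T) + vind n m h w (S ∪ T) = vind n m h w S + vind n m h w T := by
  have hle : ∀ i ∈ Finset.univ, w i * (vind n m h w (S ∩ T) i + vind n m h w (S ∪ T) i) ≤
      w i * (vind n m h w S i + vind n m h w T i) := fun i _ =>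
    mul_le_mul_of_nonneg_left (vind_inter_add_union_le hwb S T i) (hw i)
  have hsum : ∑ i, w i * (vind n m h w (S ∩ T) i + vind n m h w (S ∪ T) i) =
      ∑ i, w i * (vind n m h w S i + vind n m h w T i) := by
    refine (Finset.sum_le_sum hle).antisymm ?_
    simp only [mul_add, Finset.sum_add_distrib, ← wbf_eq_sum_mul_vind hw]
    linarith [hS (S ∩ T), hT (S ∪ T)]
  ext i
  rcases (hw i).lt_or_eq with hi | hi
  · exact mul_left_cancel₀ hi.ne' ((Finset.sum_eq_sum_iff_of_le hle).1 hsum i (Finset.mem_univ i))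
  · simp [vind, ← hi]

theorem mem_baseSetW (i : Fin n) : i ∈ baseSetW n m h w i := by
  simp [baseSetW]

theorem baseSetW_subset {U : Finset (Fin n)} {i : Fin n} (hU : isMinW n m h w U) (hi : i ∈ U) :
    baseSetW n m h w i ⊆ U := fun _ hx => (Finset.mem_filter.1 hx).2 U hU hi

theorem isMinW_baseSetW
    (hwb : ∀ S T : Finset (Fin n),
      (h (S ∩ T)).val + (h (S ∪ T)).val ≤ (h S).val + (h T).val)
    (hw : ∀ i, 0 ≤ w i) {U : Finset (Fin n)} {i : Fin n}
    (hU : isMinW n m h w U) (hi : i ∈ U) : isMinW n m h w (baseSetW n m h w i) := by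
  obtain ⟨V, -, hV⟩ := (Set.toFinite {V | isMinW n m h w V ∧ i ∈ V}).exists_le_minimal ⟨hU, hi⟩
  have hVi : V = baseSetW n m h w i := by
    refine Finset.Subset.antisymm (fun x hx => ?_) (baseSetW_subset hV.prop.1 hV.prop.2)
    refine Finset.mem_filter.2 ⟨Finset.mem_univ x, fun W hW hiW => ?_⟩
    have hVW : V ≤ V ∩ W :=
      hV.le_of_le ⟨hV.prop.1.inter hwb hw hW, Finset.mem_inter.2 ⟨hV.prop.2, hiW⟩⟩
        Finset.inter_subset_left
    exact (Finset.mem_inter.1 (hVW hx)).2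
  exact hVi ▸ hV.prop.1

/-- A nonempty minimizer that is not a base set is a union of two smaller minimizers. -/
theorem exists_union_eq_of_ne_baseSetW
    (hwb : ∀ S T : Finset (Fin n),
      (h (S ∩ T)).val + (h (S ∪ T)).val ≤ (h S).val + (h T).val)
    (hw : ∀ i, 0 ≤ w i) {S : Finset (Fin n)} (hS : isMinW n m h w S) (hne : S.Nonempty)
    (hbase : ∀ i ∈ S, S ≠ baseSetW n m h w i) :
    ∃ A B, isMinW n m h w A ∧ isMinW n m h w B ∧ A ⊂ S ∧ B ⊂ S ∧ A ∪ B = S := by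
  have hlt : ∀ i ∈ S, baseSetW n m h w i ⊂ S := fun i hi =>
    (baseSetW_subset hS hi).ssubset_of_ne (hbase i hi).symm
  obtain ⟨i, hi⟩ := hne
  obtain ⟨A, -, hA⟩ := (Set.toFinite {A | isMinW n m h w A ∧ A ⊂ S}).exists_le_maximal
    ⟨isMinW_baseSetW hwb hw hS hi, hlt i hi⟩
  obtain ⟨j, hjS, hjA⟩ := Finset.exists_of_ssubset hA.prop.2
  have hB := isMinW_baseSetW hwb hw hS hjS
  refine ⟨A, baseSetW n m h w j, hA.prop.1, hB, hA.prop.2, hlt j hjS, ?_⟩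
  by_contra hneq
  have hsub : A ∪ baseSetW n m h w j ⊆ S := Finset.union_subset hA.prop.2.subset (hlt j hjS).subset
  have hle : A ∪ baseSetW n m h w j ≤ A :=
    hA.le_of_ge ⟨hA.prop.1.union hwb hw hB, hsub.ssubset_of_ne hneq⟩ Finset.subset_union_left
  exact hjA (hle (Finset.mem_union_right _ (mem_baseSetW j)))

end

/-- For every minimizer `S` of a weight-based function, `v^S` lies in the span
of the indicator vectors of the base sets: `∅` (if it is a minimizer) together
with the sets `S_i = ⋂ {U ∈ M_f : i ∈ U}` for `i` contained in some minimizer. -/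
theorem stmt_8 (n m : ℕ) (h : Finset (Fin n) → Finset (Fin m))
    (hwb : ∀ S T : Finset (Fin n),
      (h (S ∩ T)).val + (h (S ∪ T)).val ≤ (h S).val + (h T).val)
    (w : Fin m → ℝ) (hw : ∀ i, 0 ≤ w i)
    (S : Finset (Fin n)) (hS : isMinW n m h w S) :
    vind n m h w S ∈ Submodule.span ℝ
      (vind n m h w '' {T | (T = ∅ ∧ isMinW n m h w ∅) ∨
        (∃ i : Fin n, (∃ U, isMinW n m h w U ∧ i ∈ U) ∧ T = baseSetW n m h w i)}) := by
  induction S using Finset.strongInduction with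
  | H S ih =>
    rcases S.eq_empty_or_nonempty with rfl | hne
    · exact Submodule.subset_span ⟨∅, Or.inl ⟨rfl, hS⟩, rfl⟩
    by_cases hbase : ∃ i ∈ S, S = baseSetW n m h w i
    · obtain ⟨i, hi, hSi⟩ := hbase
      exact Submodule.subset_span ⟨S, Or.inr ⟨i, ⟨S, hS, hi⟩, hSi⟩, rfl⟩
    push Not at hbase
    obtain ⟨A, B, hA, hB, hAS, hBS, hAB⟩ := exists_union_eq_of_ne_baseSetW hwb hw hS hne hbase
    have hmod := vind_inter_add_union hwb hw hA hB
    rw [hAB] at hmod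
    rw [eq_sub_of_add_eq' hmod]
    exact Submodule.sub_mem _ (Submodule.add_mem _ (ih A hAS hA) (ih B hBS hB))
      (ih (A ∩ B) (Finset.inter_subset_left.trans_ssubset hAS) (hA.inter hwb hw hB))
end

section
/- The Generalized Cut Dimension of any weight-based function is at most n + 1: if f is a weight-based function on ground set [n] with nonnegative weights and M_f is its set of minimizers over all subsets of [n], then the dimension of the linear span of {v^S : S ∈ M_f} in ℝ^m is at most n + 1. -/
open scoped Classical

/-- A nonempty family of finite sets closed under intersection has a least member. -/
theorem exists_least_of_inter_closed {α : Type*} [Finite α] [DecidableEq α] (P : Finset α → Prop)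
    (hP : ∀ S T, P S → P T → P (S ∩ T)) : ∃ M, ∀ S, P S → P M ∧ M ⊆ S := by
  by_cases hne : ∃ S, P S
  · obtain ⟨M, hM⟩ := (Set.toFinite {S | P S}).exists_minimal hne
    refine ⟨M, fun S hS => ⟨hM.prop, ?_⟩⟩
    exact (hM.le_of_le (hP M S hM.prop hS) Finset.inter_subset_left).trans
      Finset.inter_subset_right
  · exact ⟨∅, fun S hS => (hne ⟨S, hS⟩).elim⟩

/-- A vector-valued modular function on a lattice of subsets of `α` spans a space of dimension at
most `card α + 1`: it is generated by its values at the least member and at the least members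
containing each element. -/
theorem finrank_span_modular_le {α E : Type*} [Fintype α] [DecidableEq α]
    [AddCommGroup E] [Module ℝ E]
    (L : Finset α → Prop)
    (hinter : ∀ S T, L S → L T → L (S ∩ T)) (hunion : ∀ S T, L S → L T → L (S ∪ T))
    (v : Finset α → E)
    (hv : ∀ S T, L S → L T → v (S ∩ T) + v (S ∪ T) = v S + v T) :
    Module.finrank ℝ (Submodule.span ℝ {x | ∃ S, L S ∧ x = v S}) ≤ Fintype.card α + 1 := by
  obtain ⟨B, hB⟩ := exists_least_of_inter_closed L hinter
  have hleast : ∀ a : α, ∃ M, ∀ S, (L S ∧ a ∈ S) → (L M ∧ a ∈ M) ∧ M ⊆ S := fun a =>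
    exists_least_of_inter_closed (fun S => L S ∧ a ∈ S) fun S T hS hT =>
      ⟨hinter S T hS.1 hT.1, Finset.mem_inter.2 ⟨hS.2, hT.2⟩⟩
  choose J hJ using hleast
  let g : Option α → E := fun o => o.elim (v B) fun a => v (J a)
  have key : ∀ S, L S → v S ∈ Submodule.span ℝ (Set.range g) := by
    intro S
    induction S using Finset.strongInduction with
    | H S ih =>
      intro hS
      by_cases hbot : S = B
      · exact Submodule.subset_span ⟨none, by simp [g, hbot]⟩
      by_cases hirr : ∃ a, S = J a
      · obtain ⟨a, rfl⟩ := hirr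
        exact Submodule.subset_span ⟨some a, rfl⟩
      have hne : {T | L T ∧ T ⊂ S}.Nonempty :=
        ⟨B, (hB S hS).1, (hB S hS).2.ssubset_of_ne (Ne.symm hbot)⟩
      obtain ⟨P, hP⟩ := (Set.toFinite {T | L T ∧ T ⊂ S}).exists_maximal hne
      obtain ⟨hLP, hPS⟩ := hP.prop
      obtain ⟨a, haS, haP⟩ := Finset.exists_of_ssubset hPS
      obtain ⟨⟨hLJ, haJ⟩, hJS⟩ := hJ a S ⟨hS, haS⟩
      have hJss : J a ⊂ S := hJS.ssubset_of_ne fun e => hirr ⟨a, e.symm⟩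
      have hun : P ∪ J a = S := by
        by_contra hcon
        have hmem : P ∪ J a ∈ {T | L T ∧ T ⊂ S} :=
          ⟨hunion _ _ hLP hLJ, (Finset.union_subset hPS.1 hJS).ssubset_of_ne hcon⟩
        exact haP (hP.le_of_ge hmem Finset.subset_union_left (Finset.mem_union_right _ haJ))
      have hmod := hv P (J a) hLP hLJ
      rw [hun] at hmod
      rw [eq_sub_of_add_eq' hmod]
      exact Submodule.sub_mem _ (Submodule.add_mem _ (ih P hPS hLP) (ih _ hJss hLJ))
        (ih _ (Finset.inter_subset_left.trans_ssubset hPS) (hinter _ _ hLP hLJ))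
  have hle : Submodule.span ℝ {x | ∃ S, L S ∧ x = v S} ≤ Submodule.span ℝ (Set.range g) := by
    rw [Submodule.span_le]
    rintro _ ⟨S, hS, rfl⟩
    exact key S hS
  have : FiniteDimensional ℝ (Submodule.span ℝ (Set.range g)) :=
    FiniteDimensional.span_of_finite ℝ (Set.finite_range g)
  calc _ ≤ _ := Submodule.finrank_mono hle
    _ ≤ Fintype.card (Option α) := finrank_range_le_card g
    _ = _ := Fintype.card_option

theorem indicator_submodular {n m : ℕ} {h : Finset (Fin n) → Finset (Fin m)}
    (hwb : ∀ S T : Finset (Fin n),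
      (h (S ∩ T)).val + (h (S ∪ T)).val ≤ (h S).val + (h T).val)
    (S T : Finset (Fin n)) (i : Fin m) :
    ((if i ∈ h (S ∩ T) then 1 else 0) + (if i ∈ h (S ∪ T) then 1 else 0) : ℝ) ≤
      (if i ∈ h S then 1 else 0) + (if i ∈ h T then 1 else 0) := by
  have hc := Multiset.count_le_of_le i (hwb S T)
  simp only [Multiset.count_add, Multiset.count_eq_of_nodup (Finset.nodup _),
    Finset.mem_val] at hc
  exact_mod_cast hc

theorem wbf_submodular {n m : ℕ} {h : Finset (Fin n) → Finset (Fin m)}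
    (hwb : ∀ S T : Finset (Fin n),
      (h (S ∩ T)).val + (h (S ∪ T)).val ≤ (h S).val + (h T).val)
    {w : Fin m → ℝ} (hw : ∀ i, 0 ≤ w i) (S T : Finset (Fin n)) :
    wbf n m h w (S ∩ T) + wbf n m h w (S ∪ T) ≤ wbf n m h w S + wbf n m h w T := by
  simp only [wbf_eq_sum_ite, ← Finset.sum_add_distrib, ← mul_add]
  exact Finset.sum_le_sum fun i _ =>
    mul_le_mul_of_nonneg_left (indicator_submodular hwb S T i) (hw i)

theorem vind_modular {n m : ℕ} {h : Finset (Fin n) → Finset (Fin m)}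
    (hwb : ∀ S T : Finset (Fin n),
      (h (S ∩ T)).val + (h (S ∪ T)).val ≤ (h S).val + (h T).val)
    {w : Fin m → ℝ} (hw : ∀ i, 0 ≤ w i) {S T : Finset (Fin n)}
    (hST : wbf n m h w (S ∩ T) + wbf n m h w (S ∪ T) = wbf n m h w S + wbf n m h w T) :
    vind n m h w (S ∩ T) + vind n m h w (S ∪ T) = vind n m h w S + vind n m h w T := by
  simp only [wbf_eq_sum_ite, ← Finset.sum_add_distrib, ← mul_add] at hST
  rw [Finset.sum_eq_sum_iff_of_le fun i _ =>
    mul_le_mul_of_nonneg_left (indicator_submodular hwb S T i) (hw i)] at hST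
  funext i
  by_cases hi : 0 < w i
  · simpa [vind, hi] using mul_left_cancel₀ hi.ne' (hST i (Finset.mem_univ i))
  · simp [vind, hi]

/-- The Generalized Cut Dimension of any weight-based function is at most `n + 1`:
the span of the indicator vectors of the minimizers has dimension at most `n + 1`. -/
theorem stmt_9 (n m : ℕ) (h : Finset (Fin n) → Finset (Fin m))
    (hwb : ∀ S T : Finset (Fin n),
      (h (S ∩ T)).val + (h (S ∪ T)).val ≤ (h S).val + (h T).val)
    (w : Fin m → ℝ) (hw : ∀ i, 0 ≤ w i) :
    Module.finrank ℝ (Submodule.span ℝ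
      {x : Fin m → ℝ | ∃ S : Finset (Fin n), isMinW n m h w S ∧ x = vind n m h w S})
      ≤ n + 1 := by
  have hmin : ∀ S T, isMinW n m h w S → isMinW n m h w T →
      isMinW n m h w (S ∩ T) ∧ isMinW n m h w (S ∪ T) := fun S T hS hT => by
    have hsub := wbf_submodular hwb hw S T
    constructor <;> intro U
    · linarith [hS U, hT (S ∪ T)]
    · linarith [hS U, hT (S ∩ T)]
  have hdim := finrank_span_modular_le (isMinW n m h w)
    (fun S T hS hT => (hmin S T hS hT).1) (fun S T hS hT => (hmin S T hS hT).2)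
    (vind n m h w) fun S T hS hT => vind_modular hwb hw <|
      le_antisymm (wbf_submodular hwb hw S T) (add_le_add (hS _) (hT _))
  simpa using hdim
end

section
/- Let f be a weight-based function with nonnegative weights w and active-set map h. Suppose S, S_1, …, S_d ⊆ [n] and c_1, …, c_d ∈ ℝ satisfy v^S = Σ_{i=1}^d c_i · v^{S_i}. Then for every w' : [m] → ℝ such that w'_j = 0 whenever w_j = 0, one has Σ_{j ∈ h(S)} w'_j = Σ_{i=1}^d c_i · (Σ_{j ∈ h(S_i)} w'_j). -/
open scoped Classical

/-- Summing a function supported on the support of `w` over `h S` is pairing it with `v^S`. -/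
theorem sum_eq_sum_vind_mul (n m : ℕ) (h : Finset (Fin n) → Finset (Fin m))
    (w : Fin m → ℝ) (hw : ∀ i, 0 ≤ w i) (w' : Fin m → ℝ) (hw' : ∀ j, w j = 0 → w' j = 0)
    (T : Finset (Fin n)) :
    ∑ j ∈ h T, w' j = ∑ j, vind n m h w T j * w' j := by
  rw [← Finset.sum_subset (Finset.subset_univ (h T))]
  · refine Finset.sum_congr rfl fun j hj => ?_
    rcases (hw j).eq_or_lt with h0 | hpos
    · simp [hw' j h0.symm]
    · simp [vind, hj, hpos]
  · intro j _ hj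
    simp [vind, hj]

/-- If `v^S = Σ_i c_i · v^{S_i}` then for every `w'` vanishing wherever `w`
vanishes, `Σ_{j ∈ h(S)} w'_j = Σ_i c_i · Σ_{j ∈ h(S_i)} w'_j`. -/
theorem stmt_10 (n m : ℕ) (h : Finset (Fin n) → Finset (Fin m))
    (hwb : ∀ S T : Finset (Fin n),
      (h (S ∩ T)).val + (h (S ∪ T)).val ≤ (h S).val + (h T).val)
    (w : Fin m → ℝ) (hw : ∀ i, 0 ≤ w i)
    (d : ℕ) (S : Finset (Fin n)) (Si : Fin d → Finset (Fin n)) (c : Fin d → ℝ)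
    (hv : vind n m h w S = ∑ i : Fin d, c i • vind n m h w (Si i)) :
    ∀ w' : Fin m → ℝ, (∀ j, w j = 0 → w' j = 0) →
      ∑ j ∈ h S, w' j = ∑ i : Fin d, c i * ∑ j ∈ h (Si i), w' j := by
  intro w' hw'
  simp only [sum_eq_sum_vind_mul n m h w hw w' hw', hv, Finset.sum_apply, Pi.smul_apply,
    smul_eq_mul, Finset.sum_mul, Finset.mul_sum, mul_assoc]
  exact Finset.sum_comm
end

section
/- Let f be a weight-based function with nonnegative weights w, let M_f be its set of minimizers, and let d ≥ 1 be the dimension of the span of {v^S : S ∈ M_f}. Then for any d − 1 subsets T_1, …, T_{d−1} ⊆ [n] and any ε > 0, there exists w' : [m] → ℝ with w'_j ≥ 0 and |w'_j − w_j| ≤ ε·w_j for all j ∈ [m] (in particular w'_j = 0 whenever w_j = 0), such that Σ_{j ∈ h(T_k)} w'_j = Σ_{j ∈ h(T_k)} w_j for every 1 ≤ k ≤ d − 1, and yet there exists S ∈ M_f with Σ_{j ∈ h(S)} w'_j < f(S). -/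
open scoped Classical

/-- A vector bounded in support by a nonnegative weight can be rescaled to be small relative to it. -/
theorem exists_pos_mul_abs_le {ι : Type*} [Finite ι] {w x : ι → ℝ} (hw : ∀ i, 0 ≤ w i)
    (hx : ∀ i, w i = 0 → x i = 0) {δ : ℝ} (hδ : 0 < δ) :
    ∃ t : ℝ, 0 < t ∧ ∀ i, t * |x i| ≤ δ * w i := by
  have key : ∀ i, ∀ᶠ t in nhdsWithin (0 : ℝ) (Set.Ioi 0), t * |x i| ≤ δ * w i := by
    intro i
    rcases (hw i).eq_or_lt with hi | hi
    · simp [hx i hi.symm, ← hi]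
    · have hc : Filter.Tendsto (fun t : ℝ => t * |x i|) (nhdsWithin 0 (Set.Ioi 0)) (nhds 0) := by
        have : Continuous fun t : ℝ => t * |x i| := by fun_prop
        simpa using (this.tendsto 0).mono_left nhdsWithin_le_nhds
      exact hc.eventually_le_const (mul_pos hδ hi)
  obtain ⟨t, ht, h⟩ := ((Filter.eventually_mem_set.2 self_mem_nhdsWithin).and
    (Filter.eventually_all.2 key)).exists
  exact ⟨t, ht, h⟩

/-- A nonzero vector of the span of `s` is not orthogonal to all of `s`. -/
theorem exists_dotProduct_ne_zero_of_mem_span {ι : Type*} [Fintype ι] {s : Set (ι → ℝ)}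
    {x : ι → ℝ} (hx : x ∈ Submodule.span ℝ s) (hx0 : x ≠ 0) : ∃ v ∈ s, v ⬝ᵥ x ≠ 0 := by
  by_contra! hs
  refine hx0 (dotProduct_self_eq_zero.1 ?_)
  have : ∀ y ∈ Submodule.span ℝ s, y ⬝ᵥ x = 0 := by
    intro y hy
    induction hy using Submodule.span_induction with
    | mem v hv => exact hs v hv
    | zero => simp
    | add a b _ _ ha hb => simp [add_dotProduct, ha, hb]
    | smul c a _ ha => simp [smul_dotProduct, ha]
  exact this x hx

/-- Let `d ≥ 1` be the dimension of the span of the indicator vectors of the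
minimizers.  Then for any `d - 1` query sets `T_1, …, T_{d-1}` and any `ε > 0`
there is a perturbed weight vector `w'` (nonnegative, within relative `ε` of `w`,
vanishing wherever `w` does) agreeing with `w` on every query, yet strictly
decreasing the value of some minimizer. -/
theorem stmt_11 (n m : ℕ) (h : Finset (Fin n) → Finset (Fin m))
    (hwb : ∀ S T : Finset (Fin n),
      (h (S ∩ T)).val + (h (S ∪ T)).val ≤ (h S).val + (h T).val)
    (w : Fin m → ℝ) (hw : ∀ i, 0 ≤ w i)
    (d : ℕ) (hd1 : 1 ≤ d)
    (hd : d = Module.finrank ℝ (Submodule.span ℝ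
      {x : Fin m → ℝ | ∃ S : Finset (Fin n), isMinW n m h w S ∧ x = vind n m h w S}))
    (T : Fin (d - 1) → Finset (Fin n)) (ε : ℝ) (hε : 0 < ε) :
    ∃ w' : Fin m → ℝ,
      (∀ j, 0 ≤ w' j) ∧
      (∀ j, |w' j - w j| ≤ ε * w j) ∧
      (∀ j, w j = 0 → w' j = 0) ∧
      (∀ k : Fin (d - 1), ∑ j ∈ h (T k), w' j = ∑ j ∈ h (T k), w j) ∧
      (∃ S : Finset (Fin n), isMinW n m h w S ∧ ∑ j ∈ h S, w' j < wbf n m h w S) := by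
  set V := Submodule.span ℝ
    {x : Fin m → ℝ | ∃ S : Finset (Fin n), isMinW n m h w S ∧ x = vind n m h w S} with hV
  let L : V →ₗ[ℝ] (Fin (d - 1) → ℝ) :=
    (LinearMap.pi fun k => ∑ j ∈ h (T k), LinearMap.proj j) ∘ₗ V.subtype
  have hL : LinearMap.ker L ≠ ⊥ :=
    LinearMap.ker_ne_bot_of_finrank_lt (by rw [Module.finrank_fin_fun, ← hd]; omega)
  obtain ⟨⟨x, hxV⟩, hxL, hx0⟩ := Submodule.exists_mem_ne_zero_of_ne_bot hL
  have hx0 : x ≠ 0 := fun h0 => hx0 (Subtype.ext h0)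
  have hxT : ∀ k, ∑ j ∈ h (T k), x j = 0 := fun k => by
    simpa [L, LinearMap.sum_apply] using congrFun (LinearMap.mem_ker.1 hxL) k
  have hsupp : ∀ j, w j = 0 → x j = 0 := by
    intro j hj
    have hle : V ≤ LinearMap.ker (LinearMap.proj j : (Fin m → ℝ) →ₗ[ℝ] ℝ) := by
      rw [hV, Submodule.span_le]
      rintro _ ⟨S, -, rfl⟩
      simp [vind, hj]
    exact hle hxV
  obtain ⟨_, ⟨S, hS, rfl⟩, hSx⟩ := exists_dotProduct_ne_zero_of_mem_span hxV hx0
  have hdot : vind n m h w S ⬝ᵥ x = ∑ j ∈ h S, x j := by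
    rw [dotProduct, ← Finset.sum_subset (Finset.subset_univ (h S))
      fun j _ hj => by simp [vind, hj]]
    refine Finset.sum_congr rfl fun j hj => ?_
    rcases (hw j).eq_or_lt with hj0 | hj0
    · simp [hsupp j hj0.symm]
    · simp [vind, hj, hj0]
  rw [hdot] at hSx
  obtain ⟨y, hysupp, hyT, hyS⟩ : ∃ y : Fin m → ℝ, (∀ j, w j = 0 → y j = 0) ∧
      (∀ k, ∑ j ∈ h (T k), y j = 0) ∧ ∑ j ∈ h S, y j < 0 := by
    rcases hSx.lt_or_gt with hlt | hgt
    · exact ⟨x, hsupp, hxT, hlt⟩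
    · exact ⟨-x, fun j hj => by simp [hsupp j hj], fun k => by simp [hxT k], by simpa using hgt⟩
  obtain ⟨t, ht, hty⟩ := exists_pos_mul_abs_le hw hysupp (lt_min hε one_pos)
  have habs : ∀ j, |t * y j| ≤ min ε 1 * w j := fun j => by
    rw [abs_mul, abs_of_pos ht]
    exact hty j
  refine ⟨fun j => w j + t * y j, fun j => ?_, fun j => ?_, fun j hj => ?_, fun k => ?_,
    S, hS, ?_⟩
  · have h1 := (habs j).trans (mul_le_mul_of_nonneg_right (min_le_right ε 1) (hw j))
    linarith [neg_abs_le (t * y j)]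
  · simpa using (habs j).trans (mul_le_mul_of_nonneg_right (min_le_left ε 1) (hw j))
  · simp [hj, hysupp j hj]
  · rw [Finset.sum_add_distrib, ← Finset.mul_sum, hyT k, mul_zero, add_zero]
  · rw [Finset.sum_add_distrib, ← Finset.mul_sum, wbf]
    linarith [mul_neg_of_pos_of_neg ht hyS]
end

section
/- Let a ≥ 1, n = 2a + 1, and let G be the undirected graph on vertex set {v, w_1, w'_1, …, w_a, w'_a} whose edges (all of weight 1) are: an edge between v and every other vertex, and an edge between w_i and w'_i for each 1 ≤ i ≤ a. Then every nontrivial cut S (∅ ≠ S ⊊ V) has cut value f(S) ≥ 2, and f(S) = 2 if and only if S or its complement is one of the sets {w_i}, {w'_i}, or {w_i, w'_i} for some 1 ≤ i ≤ a. -/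
open scoped Classical

/-- Weights of the graph on `2a+1` vertices: vertex `0` is `v`, and for
`1 ≤ i ≤ a`, vertex `2i-1` is `w_i` and vertex `2i` is `w'_i`.  There is an
edge (of weight 1) between `v` and every other vertex, and between `w_i` and
`w'_i` for each `i`. -/
noncomputable def gw (a : ℕ) (u u' : Fin (2 * a + 1)) : ℝ :=
  if ((u : ℕ) ≠ (u' : ℕ) ∧ ((u : ℕ) = 0 ∨ (u' : ℕ) = 0)) ∨
     ((u : ℕ) % 2 = 1 ∧ (u' : ℕ) = (u : ℕ) + 1) ∨
     ((u' : ℕ) % 2 = 1 ∧ (u : ℕ) = (u' : ℕ) + 1)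
  then 1 else 0

/-- The cut function of this graph. -/
noncomputable def gcut (a : ℕ) (S : Finset (Fin (2 * a + 1))) : ℝ :=
  ∑ u ∈ S, ∑ u' ∈ Sᶜ, gw a u u'

/-- The vertex `w_i` (for `i : Fin a`, representing the paper's `w_{i+1}`). -/
def wv (a : ℕ) (i : Fin a) : Fin (2 * a + 1) :=
  ⟨2 * (i : ℕ) + 1, by have := i.isLt; omega⟩

/-- The vertex `w'_i`. -/
def wv' (a : ℕ) (i : Fin a) : Fin (2 * a + 1) :=
  ⟨2 * (i : ℕ) + 2, by have := i.isLt; omega⟩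

theorem gw_symm (a : ℕ) (u u' : Fin (2 * a + 1)) : gw a u u' = gw a u' u := by
  unfold gw
  congr 1
  apply propext
  constructor <;> intro h <;> omega

theorem gcut_compl (a : ℕ) (S : Finset (Fin (2 * a + 1))) : gcut a Sᶜ = gcut a S := by
  unfold gcut
  rw [compl_compl, Finset.sum_comm]
  exact Finset.sum_congr rfl fun u _ => Finset.sum_congr rfl fun u' _ => gw_symm a u' u

theorem sum_range_two_mul_add_one (F : ℕ → ℝ) (a : ℕ) :
    ∑ k ∈ Finset.range (2 * a + 1), F k =
      F 0 + ∑ i ∈ Finset.range a, (F (2 * i + 1) + F (2 * i + 2)) := by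
  induction a with
  | zero => simp
  | succ a ih =>
    rw [Finset.sum_range_succ _ a, ← add_assoc, ← ih,
      show 2 * (a + 1) + 1 = 2 * a + 1 + 1 + 1 by ring,
      Finset.sum_range_succ, Finset.sum_range_succ, add_assoc]

theorem sum_vertices (a : ℕ) (f : Fin (2 * a + 1) → ℝ) :
    ∑ u, f u = f 0 + ∑ i : Fin a, (f (wv a i) + f (wv' a i)) := by
  have h := sum_range_two_mul_add_one (fun k => if hk : k < 2 * a + 1 then f ⟨k, hk⟩ else 0) a
  rw [Finset.sum_range, Finset.sum_range] at h
  simp only [Fin.is_lt, dif_pos, Fin.eta] at h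
  rw [h]
  congr 1
  refine Finset.sum_congr rfl fun i _ => ?_
  have hi := i.isLt
  rw [dif_pos (by omega), dif_pos (by omega)]
  rfl

theorem vertex_cases (a : ℕ) (u : Fin (2 * a + 1)) :
    u = 0 ∨ ∃ i, u = wv a i ∨ u = wv' a i := by
  have hu := u.isLt
  by_cases h0 : (u : ℕ) = 0
  · exact Or.inl (Fin.ext h0)
  · refine Or.inr ⟨⟨((u : ℕ) - 1) / 2, by omega⟩, ?_⟩
    simp only [wv, wv', Fin.ext_iff]
    omega

theorem wv_inj (a : ℕ) (i j : Fin a) : wv a i = wv a j ↔ i = j := by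
  simp only [wv, Fin.ext_iff]; omega

theorem wv'_inj (a : ℕ) (i j : Fin a) : wv' a i = wv' a j ↔ i = j := by
  simp only [wv', Fin.ext_iff]; omega

theorem wv_ne_wv' (a : ℕ) (i j : Fin a) : wv a i ≠ wv' a j := by
  simp only [wv, wv', ne_eq, Fin.ext_iff]; omega

theorem zero_ne_wv (a : ℕ) (i : Fin a) : 0 ≠ wv a i := by
  simp [wv, Fin.ext_iff]

theorem zero_ne_wv' (a : ℕ) (i : Fin a) : 0 ≠ wv' a i := by
  simp [wv', Fin.ext_iff]

theorem gw_wv_zero (a : ℕ) (i : Fin a) : gw a (wv a i) 0 = 1 := by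
  simp [gw, wv]

theorem gw_wv'_zero (a : ℕ) (i : Fin a) : gw a (wv' a i) 0 = 1 := by
  simp [gw, wv']

theorem gw_wv_wv (a : ℕ) (i j : Fin a) : gw a (wv a i) (wv a j) = 0 := by
  unfold gw
  exact if_neg (by simp only [wv]; omega)

theorem gw_wv'_wv' (a : ℕ) (i j : Fin a) : gw a (wv' a i) (wv' a j) = 0 := by
  unfold gw
  exact if_neg (by simp only [wv']; omega)

theorem gw_wv_wv' (a : ℕ) (i j : Fin a) :
    gw a (wv a i) (wv' a j) = if i = j then 1 else 0 := by
  simp only [gw, wv, wv', Fin.ext_iff]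
  congr 1
  apply propext
  omega

theorem gcut_eq_of_zero_notMem (a : ℕ) (S : Finset (Fin (2 * a + 1))) (h0 : 0 ∉ S) :
    gcut a S =
      2 * ((Finset.univ.filter fun i : Fin a => wv a i ∈ S ∨ wv' a i ∈ S).card : ℝ) := by
  have hrow : ∀ u, ∑ u' ∈ Sᶜ, gw a u u' = gw a u 0 + ∑ j : Fin a,
      ((if wv a j ∈ S then 0 else gw a u (wv a j)) +
        (if wv' a j ∈ S then 0 else gw a u (wv' a j))) := by
    intro u
    have : ∑ u' ∈ Sᶜ, gw a u u' = ∑ x, if x ∈ S then 0 else gw a u x := by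
      rw [← Finset.sum_subset (Finset.subset_univ Sᶜ)]
      · exact Finset.sum_congr rfl fun x hx => by rw [if_neg (Finset.mem_compl.mp hx)]
      · intro x _ hx
        rw [if_pos (by simpa using hx)]
    rw [this, sum_vertices, if_neg h0]
  have hS : gcut a S = ∑ u, if u ∈ S then ∑ u' ∈ Sᶜ, gw a u u' else 0 := by
    simp [gcut]
  rw [hS, sum_vertices, if_neg h0, zero_add, Finset.card_filter]
  push_cast
  rw [Finset.mul_sum]
  refine Finset.sum_congr rfl fun i _ => ?_
  have hw : ∑ u' ∈ Sᶜ, gw a (wv a i) u' = 1 + if wv' a i ∈ S then 0 else 1 := by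
    rw [hrow, gw_wv_zero, Finset.sum_eq_single i]
    · simp [gw_wv_wv, gw_wv_wv']
    · intro j _ hj
      simp [gw_wv_wv, gw_wv_wv', hj.symm]
    · simp
  have hw' : ∑ u' ∈ Sᶜ, gw a (wv' a i) u' = 1 + if wv a i ∈ S then 0 else 1 := by
    rw [hrow, gw_wv'_zero, Finset.sum_eq_single i]
    · simp [gw_wv'_wv', gw_symm a (wv' a i), gw_wv_wv']
    · intro j _ hj
      simp [gw_wv'_wv', gw_symm a (wv' a i) (wv a j), gw_wv_wv', hj]
    · simp
  rw [hw, hw']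
  by_cases h : wv a i ∈ S <;> by_cases h' : wv' a i ∈ S <;> simp [h, h'] <;> norm_num

theorem gcut_of_zero_notMem (a : ℕ) (S : Finset (Fin (2 * a + 1))) (h1 : S ≠ ∅) (h0 : 0 ∉ S) :
    2 ≤ gcut a S ∧
    (gcut a S = 2 ↔ ∃ i : Fin a, S = {wv a i} ∨ S = {wv' a i} ∨ S = {wv a i, wv' a i}) := by
  rw [gcut_eq_of_zero_notMem a S h0]
  set T := Finset.univ.filter fun i : Fin a => wv a i ∈ S ∨ wv' a i ∈ S with hT
  have hmem : ∀ i, i ∈ T ↔ wv a i ∈ S ∨ wv' a i ∈ S := fun i => by simp [hT]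
  have hpos : 1 ≤ T.card := by
    obtain ⟨u, hu⟩ := Finset.nonempty_iff_ne_empty.mpr h1
    rw [Nat.succ_le_iff, Finset.card_pos]
    rcases vertex_cases a u with rfl | ⟨i, rfl | rfl⟩
    · exact absurd hu h0
    · exact ⟨i, (hmem i).mpr (Or.inl hu)⟩
    · exact ⟨i, (hmem i).mpr (Or.inr hu)⟩
  have hpos' : (1 : ℝ) ≤ T.card := by exact_mod_cast hpos
  refine ⟨by linarith, ?_⟩
  have hcard : 2 * (T.card : ℝ) = 2 ↔ T.card = 1 := by
    rw [← Nat.cast_inj (R := ℝ)]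
    constructor <;> intro h <;> push_cast at * <;> linarith
  rw [hcard, Finset.card_eq_one]
  refine exists_congr fun i => ⟨fun h => ?_, fun h => ?_⟩
  · have hi : wv a i ∈ S ∨ wv' a i ∈ S := (hmem i).mp (by simp [h])
    have hj : ∀ j, wv a j ∈ S ∨ wv' a j ∈ S → j = i := fun j hj => by
      simpa [h] using (hmem j).mpr hj
    have hsub : ∀ u ∈ S, u = wv a i ∨ u = wv' a i := by
      intro u hu
      rcases vertex_cases a u with rfl | ⟨j, rfl | rfl⟩
      · exact absurd hu h0
      · exact Or.inl (by rw [hj j (Or.inl hu)])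
      · exact Or.inr (by rw [hj j (Or.inr hu)])
    by_cases hw : wv a i ∈ S <;> by_cases hw' : wv' a i ∈ S
    · refine Or.inr (Or.inr ?_)
      ext u
      simp only [Finset.mem_insert, Finset.mem_singleton]
      exact ⟨hsub u, by rintro (rfl | rfl) <;> assumption⟩
    · refine Or.inl ?_
      ext u
      rw [Finset.mem_singleton]
      refine ⟨fun hu => (hsub u hu).resolve_right ?_, by rintro rfl; exact hw⟩
      rintro rfl
      exact hw' hu
    · refine Or.inr (Or.inl ?_)
      ext u
      rw [Finset.mem_singleton]
      refine ⟨fun hu => (hsub u hu).resolve_left ?_, by rintro rfl; exact hw'⟩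
      rintro rfl
      exact hw hu
    · exact absurd hi (by tauto)
  · ext j
    rw [hmem, Finset.mem_singleton]
    rcases h with h | h | h <;>
      simp [h, wv_inj, wv'_inj, wv_ne_wv', (wv_ne_wv' a _ _).symm]

/-- Every nontrivial cut of this graph has value at least 2, with equality iff
`S` or its complement is `{w_i}`, `{w'_i}`, or `{w_i, w'_i}` for some `i`. -/
theorem stmt_12 (a : ℕ) (ha : 1 ≤ a) (S : Finset (Fin (2 * a + 1)))
    (h1 : S ≠ ∅) (h2 : S ≠ Finset.univ) :
    2 ≤ gcut a S ∧
    (gcut a S = 2 ↔ ∃ i : Fin a,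
      S = {wv a i} ∨ S = {wv' a i} ∨ S = {wv a i, wv' a i} ∨
      S = {wv a i}ᶜ ∨ S = {wv' a i}ᶜ ∨ S = {wv a i, wv' a i}ᶜ) := by
  by_cases h0 : 0 ∈ S
  · obtain ⟨hle, hiff⟩ := gcut_of_zero_notMem a Sᶜ (by simpa using h2) (by simpa using h0)
    rw [gcut_compl] at hle hiff
    refine ⟨hle, hiff.trans (exists_congr fun i => ?_)⟩
    have hc : ∀ X : Finset (Fin (2 * a + 1)), Sᶜ = X ↔ S = Xᶜ := fun X =>
      compl_eq_comm.trans eq_comm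
    rw [hc, hc, hc]
    refine ⟨fun h => by tauto, ?_⟩
    rintro (h | h | h | h)
    · simp [h, zero_ne_wv] at h0
    · simp [h, zero_ne_wv'] at h0
    · simp [h, zero_ne_wv, zero_ne_wv'] at h0
    · exact h
  · obtain ⟨hle, hiff⟩ := gcut_of_zero_notMem a S h1 h0
    refine ⟨hle, hiff.trans (exists_congr fun i => ⟨fun h => by tauto, ?_⟩)⟩
    rintro (h | h | h | h | h | h)
    · exact Or.inl h
    · exact Or.inr (Or.inl h)
    · exact Or.inr (Or.inr h)
    · simp [h, zero_ne_wv] at h0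
    · simp [h, zero_ne_wv'] at h0
    · simp [h, zero_ne_wv, zero_ne_wv'] at h0
end

section
/- For every n ≥ 3 there exists an undirected graph on n vertices with nonnegative edge weights whose global cut dimension is at least ⌊3(n−1)/2⌋; that is, the dimension of the linear span of the indicator vectors of its minimum nontrivial cuts is at least ⌊3(n−1)/2⌋ (which equals 3n/2 − 2 when n is even and 3(n−1)/2 when n is odd). -/
open scoped Classical

/-- The cut function of a weighted undirected graph on `Fin n` with weight
function `w`. -/
noncomputable def cutFun (n : ℕ) (w : Fin n → Fin n → ℝ) (S : Finset (Fin n)) : ℝ :=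
  ∑ u ∈ S, ∑ u' ∈ Sᶜ, w u u'

/-- The cut-indicator vector of `S`, indexed by unordered vertex pairs:
coordinate `{u, u'}` is 1 iff `w u u' > 0` and exactly one of `u, u'` lies in
`S`.  (Requires symmetry of `w` to be well-defined.) -/
noncomputable def cutIndic (n : ℕ) (w : Fin n → Fin n → ℝ)
    (hsymm : ∀ u u', w u u' = w u' u) (S : Finset (Fin n)) : Sym2 (Fin n) → ℝ :=
  Sym2.lift ⟨fun u u' =>
      if 0 < w u u' ∧ ((u ∈ S ∧ u' ∉ S) ∨ (u' ∈ S ∧ u ∉ S)) then 1 else 0,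
    fun u u' => by
      dsimp only
      rw [hsymm u u']
      exact if_congr (by tauto) rfl rfl⟩

/-- Edge weights of a windmill on `Fin n`: triangles `{0, 2k+1, 2k+2}` with unit weights, and, when
`n` is even, a pendant edge from `0` to `n - 1` of weight `2`. -/
noncomputable def windmill (n : ℕ) (u v : Fin n) : ℝ :=
  if u = v then 0
  else if u.val = 0 ∨ v.val = 0 then (if u.val + v.val + 1 = n ∧ n % 2 = 0 then 2 else 1)
  else if (u.val + 1) / 2 = (v.val + 1) / 2 then 1 else 0

namespace windmill

variable {n : ℕ}

theorem comm (u v : Fin n) : windmill n u v = windmill n v u := by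
  unfold windmill
  simp only [eq_comm (a := u), or_comm (a := u.val = 0), add_comm u.val]
  grind

theorem self (u : Fin n) : windmill n u u = 0 := by simp [windmill]

theorem nonneg (u v : Fin n) : 0 ≤ windmill n u v := by
  unfold windmill; split_ifs <;> norm_num

/-- `a` and `b` are the two non-central vertices of a triangle. -/
structure Mates (a b : Fin n) : Prop where
  left : a.val ≠ 0
  right : b.val ≠ 0
  ne : a.val ≠ b.val
  block : (a.val + 1) / 2 = (b.val + 1) / 2

theorem Mates.symm {a b : Fin n} (h : Mates a b) : Mates b a :=
  ⟨h.right, h.left, h.ne.symm, h.block.symm⟩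

theorem Mates.spoke {a b z : Fin n} (h : Mates a b) (hz : z.val = 0) : windmill n z a = 1 := by
  obtain ⟨h1, h2, h3, h4⟩ := h
  have := b.isLt
  unfold windmill
  rw [if_neg (by rw [Fin.ext_iff]; omega), if_pos (by omega), if_neg (by omega)]

theorem Mates.rim {a b : Fin n} (h : Mates a b) : windmill n a b = 1 := by
  obtain ⟨h1, h2, h3, h4⟩ := h
  unfold windmill
  rw [if_neg (by rw [Fin.ext_iff]; omega), if_neg (by omega), if_pos (by omega)]

theorem Mates.eq_zero {a b v : Fin n} (h : Mates a b) (hv : v.val ≠ 0) (hvb : v ≠ b) :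
    windmill n a v = 0 := by
  obtain ⟨h1, h2, h3, h4⟩ := h
  rw [Ne, Fin.ext_iff] at hvb
  unfold windmill
  split_ifs <;> simp_all [Fin.ext_iff]
  omega

theorem pendant_spoke {a z : Fin n} (hz : z.val = 0) (ha : a.val + 1 = n) (hn : n % 2 = 0) :
    windmill n z a = 2 := by
  unfold windmill
  rw [if_neg (by rw [Fin.ext_iff]; omega), if_pos (by omega), if_pos (by omega)]

theorem pendant_eq_zero {a v : Fin n} (ha : a.val + 1 = n) (hn : n % 2 = 0) (hv : v.val ≠ 0) :
    windmill n a v = 0 := by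
  have := v.isLt
  unfold windmill
  split_ifs with h1 <;> first | rfl | (rw [Fin.ext_iff] at h1; omega)

theorem exists_mates_or_pendant (a : Fin n) (ha : a.val ≠ 0) :
    (∃ b, Mates a b) ∨ (a.val + 1 = n ∧ n % 2 = 0) := by
  have := a.isLt
  rcases Nat.even_or_odd' a.val with ⟨k, hk | hk⟩
  · exact .inl ⟨⟨a.val - 1, by omega⟩, ha, by dsimp; omega, by dsimp; omega, by dsimp; omega⟩
  · by_cases h : a.val + 1 = n
    · exact .inr ⟨h, by omega⟩
    · exact .inl ⟨⟨a.val + 1, by omega⟩, ha, by dsimp; omega, by dsimp; omega, by dsimp; omega⟩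

theorem cutFun_compl (T : Finset (Fin n)) :
    cutFun n (windmill n) Tᶜ = cutFun n (windmill n) T := by
  unfold cutFun
  rw [compl_compl, Finset.sum_comm]
  simp only [comm]

theorem le_cutFun_of_subset {T : Finset (Fin n)} {P : Finset (Fin n × Fin n)}
    (hP : P ⊆ T ×ˢ Tᶜ) : ∑ p ∈ P, windmill n p.1 p.2 ≤ cutFun n (windmill n) T := by
  unfold cutFun
  rw [← Finset.sum_product']
  exact Finset.sum_le_sum_of_subset_of_nonneg hP fun p _ _ => nonneg p.1 p.2

theorem two_le_cutFun_of_mem {T : Finset (Fin n)} {z a : Fin n} (hz : z.val = 0) (hzT : z ∈ T)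
    (ha : a ∉ T) : 2 ≤ cutFun n (windmill n) T := by
  have ha0 : a.val ≠ 0 := fun h => ha (by rwa [Fin.ext (h.trans hz.symm)])
  rcases exists_mates_or_pendant a ha0 with ⟨b, hb⟩ | ⟨h1, h2⟩
  · have hab : a ≠ b := fun h => hb.ne (congrArg _ h)
    have hzb : z ≠ b := fun h => hb.right (h ▸ hz)
    by_cases hbT : b ∈ T
    · refine le_trans ?_ (le_cutFun_of_subset (P := {(z, a), (b, a)}) ?_)
      · rw [Finset.sum_pair (by simp [hzb]), hb.spoke hz, hb.symm.rim]; norm_num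
      · simp [Finset.insert_subset_iff, *]
    · refine le_trans ?_ (le_cutFun_of_subset (P := {(z, a), (z, b)}) ?_)
      · rw [Finset.sum_pair (by simp [hab]), hb.spoke hz, hb.symm.spoke hz]; norm_num
      · simp [Finset.insert_subset_iff, *]
  · refine le_trans ?_ (le_cutFun_of_subset (P := {(z, a)}) ?_)
    · rw [Finset.sum_singleton, pendant_spoke hz h1 h2]
    · simp [*]

theorem two_le_cutFun {T : Finset (Fin n)} (h₀ : T ≠ ∅) (h₁ : T ≠ Finset.univ) :
    2 ≤ cutFun n (windmill n) T := by
  obtain ⟨x, hx⟩ := Finset.nonempty_iff_ne_empty.2 h₀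
  obtain ⟨y, hy⟩ : ∃ y, y ∉ T := by
    by_contra! h
    exact h₁ (Finset.eq_univ_iff_forall.2 h)
  let z : Fin n := ⟨0, x.pos⟩
  by_cases hz : z ∈ T
  · exact two_le_cutFun_of_mem rfl hz hy
  · rw [← cutFun_compl]
    exact two_le_cutFun_of_mem (z := z) (a := x) rfl (by simpa using hz) (by simpa using hx)

/-- The span of the cut-indicator vectors of the global mincuts of the windmill. -/
noncomputable def mincutSpan (n : ℕ) : Submodule ℝ (Sym2 (Fin n) → ℝ) :=
  Submodule.span ℝ {x | ∃ S : Finset (Fin n),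
    (S ≠ ∅ ∧ S ≠ Finset.univ ∧
      ∀ T : Finset (Fin n), T ≠ ∅ → T ≠ Finset.univ →
        cutFun n (windmill n) S ≤ cutFun n (windmill n) T) ∧
    x = cutIndic n (windmill n) comm S}

theorem cutIndic_mem_mincutSpan {S : Finset (Fin n)} {z a : Fin n} (ha : a ∈ S) (hz : z ∉ S)
    (h : cutFun n (windmill n) S = 2) :
    cutIndic n (windmill n) comm S ∈ mincutSpan n := by
  refine Submodule.subset_span ⟨S, ⟨Finset.ne_empty_of_mem ha, ?_, ?_⟩, rfl⟩
  · rintro rfl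
    exact hz (Finset.mem_univ z)
  · exact fun T h₀ h₁ => h.le.trans (two_le_cutFun h₀ h₁)

theorem Mates.cutFun_singleton {a b z : Fin n} (h : Mates a b) (hz : z.val = 0) :
    cutFun n (windmill n) {a} = 2 := by
  have hab : b ≠ a := fun h' => h.ne (congrArg _ h'.symm)
  have hzb : z ≠ b := fun h' => h.right (h' ▸ hz)
  have hza : z ≠ a := fun h' => h.left (h' ▸ hz)
  rw [cutFun, Finset.sum_singleton, ← Finset.sum_subset (s₁ := {z, b}), Finset.sum_pair hzb, h.rim,
    comm, h.spoke hz]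
  · norm_num
  · simp [hza.symm, hab.symm]
  · intro v _ hv
    simp only [Finset.mem_insert, Finset.mem_singleton, not_or] at hv
    exact h.eq_zero (fun h' => hv.1 (Fin.ext (h'.trans hz.symm))) hv.2

theorem Mates.cutFun_pair {a b z : Fin n} (h : Mates a b) (hz : z.val = 0) :
    cutFun n (windmill n) {a, b} = 2 := by
  have hab : a ≠ b := fun h' => h.ne (congrArg _ h')
  have hzb : z ≠ b := fun h' => h.right (h' ▸ hz)
  have hza : z ≠ a := fun h' => h.left (h' ▸ hz)
  have hmem : z ∈ ({a, b} : Finset (Fin n))ᶜ := by simp [*]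
  rw [cutFun, Finset.sum_pair hab, Finset.sum_eq_single_of_mem z hmem,
    Finset.sum_eq_single_of_mem z hmem, comm, h.spoke hz, comm, h.symm.spoke hz]
  · norm_num
  · intro v hv hvz
    simp only [Finset.mem_compl, Finset.mem_insert, Finset.mem_singleton, not_or] at hv
    exact h.symm.eq_zero (fun h' => hvz (Fin.ext (h'.trans hz.symm))) hv.1
  · intro v hv hvz
    simp only [Finset.mem_compl, Finset.mem_insert, Finset.mem_singleton, not_or] at hv
    exact h.eq_zero (fun h' => hvz (Fin.ext (h'.trans hz.symm))) hv.2

theorem pendant_cutFun {a z : Fin n} (hz : z.val = 0) (ha : a.val + 1 = n) (hn : n % 2 = 0) :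
    cutFun n (windmill n) {a} = 2 := by
  have hza : z ≠ a := by rw [Ne, Fin.ext_iff]; omega
  rw [cutFun, Finset.sum_singleton, Finset.sum_eq_single_of_mem z (by simp [hza]), comm,
    pendant_spoke hz ha hn]
  exact fun v _ hv => pendant_eq_zero ha hn fun h' => hv (Fin.ext (h'.trans hz.symm))

theorem pos_iff (u v : Fin n) : 0 < windmill n u v ↔
    u.val ≠ v.val ∧ (u.val = 0 ∨ v.val = 0 ∨ (u.val + 1) / 2 = (v.val + 1) / 2) := by
  unfold windmill
  split_ifs <;> simp_all [Fin.ext_iff] <;> tauto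

theorem Mates.cutIndic_singleton {a b z : Fin n} (h : Mates a b) (hz : z.val = 0) :
    cutIndic n (windmill n) comm {a} = Pi.single s(z, a) 1 + Pi.single s(a, b) 1 := by
  obtain ⟨h1, h2, h3, h4⟩ := h
  ext e
  induction e with | _ u v
  simp only [cutIndic, Sym2.lift_mk, pos_iff, Finset.mem_singleton, Pi.add_apply, Pi.single_apply,
    Sym2.eq_iff, Fin.ext_iff, hz]
  split_ifs <;> first | (exfalso; omega) | norm_num

theorem Mates.cutIndic_pair {a b z : Fin n} (h : Mates a b) (hz : z.val = 0) :
    cutIndic n (windmill n) comm {a, b} = Pi.single s(z, a) 1 + Pi.single s(z, b) 1 := by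
  obtain ⟨h1, h2, h3, h4⟩ := h
  ext e
  induction e with | _ u v
  simp only [cutIndic, Sym2.lift_mk, pos_iff, Finset.mem_insert, Finset.mem_singleton,
    Pi.add_apply, Pi.single_apply, Sym2.eq_iff, Fin.ext_iff, hz]
  split_ifs <;> first | (exfalso; omega) | norm_num

theorem pendant_cutIndic {a z : Fin n} (hz : z.val = 0) (ha : a.val + 1 = n) (hn : n % 2 = 0) :
    cutIndic n (windmill n) comm {a} = Pi.single s(z, a) 1 := by
  ext e
  induction e with | _ u v
  have := u.isLt
  have := v.isLt
  simp only [cutIndic, Sym2.lift_mk, pos_iff, Finset.mem_singleton, Pi.single_apply,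
    Sym2.eq_iff, Fin.ext_iff, hz]
  split_ifs <;> first | (exfalso; omega) | rfl

theorem Mates.single_mem {a b z : Fin n} (h : Mates a b) (hz : z.val = 0) :
    Pi.single s(z, a) 1 ∈ mincutSpan n ∧ Pi.single s(a, b) 1 ∈ mincutSpan n := by
  have hzb : z ≠ b := fun h' => h.right (h' ▸ hz)
  have hza : z ≠ a := fun h' => h.left (h' ▸ hz)
  have ma := cutIndic_mem_mincutSpan (z := z) (Finset.mem_singleton_self a) (by simp [hza])
    (h.cutFun_singleton hz)
  have mb := cutIndic_mem_mincutSpan (z := z) (Finset.mem_singleton_self b) (by simp [hzb])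
    (h.symm.cutFun_singleton hz)
  have mab := cutIndic_mem_mincutSpan (z := z) (Finset.mem_insert_self a {b}) (by simp [hza, hzb])
    (h.cutFun_pair hz)
  rw [h.cutIndic_singleton hz] at ma
  rw [h.symm.cutIndic_singleton hz, Sym2.eq_swap (a := b)] at mb
  rw [h.cutIndic_pair hz] at mab
  have key : (Pi.single s(z, a) 1 : Sym2 (Fin n) → ℝ) ∈ mincutSpan n := by
    convert (mincutSpan n).smul_mem (1 / 2 : ℝ)
      ((mincutSpan n).sub_mem ((mincutSpan n).add_mem ma mab) mb) using 1
    module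
  exact ⟨key, ((mincutSpan n).add_mem_iff_right key).1 ma⟩

theorem spoke_mem {a z : Fin n} (hz : z.val = 0) (ha : a.val ≠ 0) :
    Pi.single s(z, a) 1 ∈ mincutSpan n := by
  rcases exists_mates_or_pendant a ha with ⟨b, hb⟩ | ⟨h1, h2⟩
  · exact (hb.single_mem hz).1
  · rw [← pendant_cutIndic hz h1 h2]
    refine cutIndic_mem_mincutSpan (z := z) (Finset.mem_singleton_self a) ?_
      (pendant_cutFun hz h1 h2)
    rw [Finset.mem_singleton, Fin.ext_iff]
    omega

/-- The edges of the windmill: `n - 1` spokes and `(n - 1) / 2` rim edges. -/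
def edge (n : ℕ) : Fin (n - 1) ⊕ Fin ((n - 1) / 2) → Sym2 (Fin n)
  | .inl i => s(⟨0, by have := i.isLt; omega⟩, ⟨i + 1, by omega⟩)
  | .inr k => s(⟨2 * k + 1, by omega⟩, ⟨2 * k + 2, by omega⟩)

theorem edge_injective : Function.Injective (edge n) := by
  rintro (i | i) (j | j) h <;>
    simp only [edge, Sym2.eq_iff, Fin.ext_iff, Sum.inl.injEq, Sum.inr.injEq] at h ⊢ <;> omega

theorem single_edge_mem (i : Fin (n - 1) ⊕ Fin ((n - 1) / 2)) :
    Pi.single (edge n i) 1 ∈ mincutSpan n := by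
  rcases i with i | k
  · exact spoke_mem rfl (by simp)
  · have h : Mates (n := n) ⟨2 * k + 1, by omega⟩ ⟨2 * k + 2, by omega⟩ :=
      ⟨by simp, by simp, by simp, by dsimp; omega⟩
    exact (h.single_mem (z := ⟨0, by have := k.isLt; omega⟩) rfl).2

theorem le_finrank_mincutSpan : 3 * (n - 1) / 2 ≤ Module.finrank ℝ (mincutSpan n) := by
  have hli := (Pi.basisFun ℝ (Sym2 (Fin n))).linearIndependent.comp (edge n) edge_injective
  have hle : Submodule.span ℝ (Set.range (Pi.basisFun ℝ (Sym2 (Fin n)) ∘ edge n)) ≤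
      mincutSpan n := by
    rw [Submodule.span_le]
    rintro _ ⟨i, rfl⟩
    simpa using single_edge_mem i
  have := Submodule.finrank_mono hle
  rw [finrank_span_eq_card hli, Fintype.card_sum, Fintype.card_fin, Fintype.card_fin] at this
  omega

end windmill

/-- For every `n ≥ 3` there is an undirected weighted graph on `n` vertices
whose global cut dimension is at least `⌊3(n-1)/2⌋`: the span of the indicator
vectors of its minimum nontrivial cuts has dimension at least `⌊3(n-1)/2⌋`. -/
theorem stmt_14 (n : ℕ) (hn : 3 ≤ n) :
    ∃ (w : Fin n → Fin n → ℝ) (hsymm : ∀ u u', w u u' = w u' u),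
      (∀ u u', 0 ≤ w u u') ∧ (∀ u, w u u = 0) ∧
      3 * (n - 1) / 2 ≤ Module.finrank ℝ (Submodule.span ℝ
        {x : Sym2 (Fin n) → ℝ | ∃ S : Finset (Fin n),
          (S ≠ ∅ ∧ S ≠ Finset.univ ∧
            ∀ T : Finset (Fin n), T ≠ ∅ → T ≠ Finset.univ →
              cutFun n w S ≤ cutFun n w T) ∧
          x = cutIndic n w hsymm S}) := by
  exact ⟨windmill n, windmill.comm, windmill.nonneg, windmill.self, windmill.le_finrank_mincutSpan⟩
end

section
/- For every n ≥ 4 there exist a submodular function f : 2^[n] → ℝ and, for each pair 1 ≤ i < j ≤ n, a submodular function f_{ij} : 2^[n] → ℝ, such that: f_{ij}(S) = f(S) for every S ⊆ [n] with S ≠ [n] \ {i, j}; the minimum of f over nontrivial sets (S ∉ {∅, [n]}) equals 0; and for every pair i < j, the minimum of f_{ij} over nontrivial sets equals −1. -/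
open Finset in
/-- Truncated excess of cardinality over `m` is supermodular. -/
theorem Finset.card_tsub_supermodular {α : Type*} [DecidableEq α] (m : ℕ) (X Y : Finset α) :
    (#X - m) + (#Y - m) ≤ (#(X ∪ Y) - m) + (#(X ∩ Y) - m) := by
  have h := card_union_add_card_inter X Y
  have hX := card_le_card (subset_union_left : X ⊆ X ∪ Y)
  have hY := card_le_card (subset_union_right : Y ⊆ X ∪ Y)
  omega

open Finset in
/-- Truncated excess of cardinality over `#T` remains supermodular after raising its value
at `T` by one. -/
theorem Finset.card_tsub_add_indicator_supermodular {α : Type*} [DecidableEq α]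
    (T X Y : Finset α) :
    (#X - #T + if X = T then 1 else 0) + (#Y - #T + if Y = T then 1 else 0) ≤
      (#(X ∪ Y) - #T + if X ∪ Y = T then 1 else 0) +
        (#(X ∩ Y) - #T + if X ∩ Y = T then 1 else 0) := by
  by_cases hXY : X ⊆ Y
  · rw [union_eq_right.2 hXY, inter_eq_left.2 hXY, add_comm]
  by_cases hYX : Y ⊆ X
  · rw [union_eq_left.2 hYX, inter_eq_right.2 hYX]
  have h := card_tsub_supermodular #T X Y
  have hX : #X < #(X ∪ Y) := card_lt_card (left_lt_sup.2 hYX)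
  have hY : #Y < #(X ∪ Y) := card_lt_card (right_lt_sup.2 hXY)
  by_cases h1 : X = T
  · have h2 : Y ≠ T := fun h2 => hXY (h1.trans h2.symm).subset
    have h3 : #X = #T := congrArg card h1
    rw [if_pos h1, if_neg h2]
    omega
  · by_cases h2 : Y = T
    · have h3 : #Y = #T := congrArg card h2
      rw [if_neg h1, if_pos h2]
      omega
    · rw [if_neg h1, if_neg h2]
      omega

/-- For every `n ≥ 4` there exist a submodular `f` and, for each pair `i < j`,
a submodular `f_{ij}`, such that `f_{ij}` agrees with `f` on every set other
than `[n] \ {i, j}`, the minimum of `f` over nontrivial sets is `0`, and the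
minimum of each `f_{ij}` over nontrivial sets is `-1`. -/
theorem stmt_16 (n : ℕ) (hn : 4 ≤ n) :
    ∃ (f : Finset (Fin n) → ℝ) (fij : Fin n → Fin n → Finset (Fin n) → ℝ),
      (∀ X Y : Finset (Fin n), f (X ∪ Y) + f (X ∩ Y) ≤ f X + f Y) ∧
      (∀ i j : Fin n, i < j → ∀ X Y : Finset (Fin n),
        fij i j (X ∪ Y) + fij i j (X ∩ Y) ≤ fij i j X + fij i j Y) ∧
      (∀ i j : Fin n, i < j → ∀ S : Finset (Fin n),
        S ≠ Finset.univ \ {i, j} → fij i j S = f S) ∧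
      IsLeast {x : ℝ | ∃ S : Finset (Fin n),
        S ≠ ∅ ∧ S ≠ Finset.univ ∧ x = f S} 0 ∧
      (∀ i j : Fin n, i < j →
        IsLeast {x : ℝ | ∃ S : Finset (Fin n),
          S ≠ ∅ ∧ S ≠ Finset.univ ∧ x = fij i j S} (-1)) := by
  have card_T {i j : Fin n} (hij : i < j) :
      (Finset.univ \ {i, j} : Finset (Fin n)).card = n - 2 := by
    rw [Finset.card_sdiff_of_subset (Finset.subset_univ _), Finset.card_pair hij.ne]
    simp
  have hcard (X Y : Finset (Fin n)) :
      ((X ∪ Y).card : ℝ) + (X ∩ Y).card = X.card + Y.card := by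
    exact_mod_cast Finset.card_union_add_card_inter X Y
  have hn' : (4 : ℝ) ≤ n := by exact_mod_cast hn
  let f : Finset (Fin n) → ℝ := fun S => S.card - 1 - (n - 2) * (S.card - (n - 2) : ℕ)
  have f_nonneg (S : Finset (Fin n)) (h0 : S ≠ ∅) (h1 : S ≠ Finset.univ) : 0 ≤ f S := by
    have hpos : 1 ≤ S.card := Finset.one_le_card.2 (Finset.nonempty_iff_ne_empty.2 h0)
    have hlt : S.card < n := by simpa using (Finset.card_lt_iff_ne_univ S).2 h1
    have hpos' : (1 : ℝ) ≤ S.card := by exact_mod_cast hpos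
    rcases Nat.lt_or_ge (n - 2) S.card with h | h
    · have e : S.card - (n - 2) = 1 := by omega
      have e' : (S.card : ℝ) + 1 = n := by exact_mod_cast (by omega : S.card + 1 = n)
      simp only [f, e]
      push_cast
      linarith
    · simp only [f, Nat.sub_eq_zero_of_le h]
      push_cast
      linarith
  refine ⟨f, fun i j S => f S - (n - 2) * ((if S = Finset.univ \ {i, j} then 1 else 0 : ℕ) : ℝ),
    fun X Y => ?_, fun i j hij X Y => ?_, fun i j _ S hS => by simp [hS],
    ⟨?_, ?_⟩, fun i j hij => ⟨?_, ?_⟩⟩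
  · have h := (Nat.cast_le (α := ℝ)).2 (Finset.card_tsub_supermodular (n - 2) X Y)
    rw [Nat.cast_add, Nat.cast_add] at h
    simp only [f]
    linarith [hcard X Y, mul_le_mul_of_nonneg_left h (by linarith : (0 : ℝ) ≤ n - 2)]
  · have h := (Nat.cast_le (α := ℝ)).2
      (Finset.card_tsub_add_indicator_supermodular (Finset.univ \ {i, j}) X Y)
    rw [card_T hij] at h
    simp only [Nat.cast_add] at h
    simp only [f]
    linarith [hcard X Y, mul_le_mul_of_nonneg_left h (by linarith : (0 : ℝ) ≤ n - 2)]
  · have e : 1 - (n - 2) = 0 := by omega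
    refine ⟨{⟨0, by omega⟩}, Finset.singleton_ne_empty _, fun h => ?_, by simp [f, e]⟩
    have := congrArg Finset.card h
    simp at this
    omega
  · rintro _ ⟨S, h0, h1, rfl⟩
    exact f_nonneg S h0 h1
  · have hT := card_T hij
    refine ⟨Finset.univ \ {i, j}, fun h => ?_, fun h => ?_, ?_⟩
    · rw [h, Finset.card_empty] at hT
      omega
    · rw [h, Finset.card_univ, Fintype.card_fin] at hT
      omega
    · simp only [f, hT, Nat.sub_self, if_true]
      rw [Nat.cast_sub (by omega)]
      push_cast
      ring
  · rintro _ ⟨S, h0, h1, rfl⟩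
    by_cases hS : S = Finset.univ \ {i, j}
    · have hT := card_T hij
      rw [← hS] at hT
      simp only [f, hT, Nat.sub_self, if_pos hS]
      rw [Nat.cast_sub (by omega)]
      push_cast
      linarith
    · have := f_nonneg S h0 h1
      simp only [if_neg hS, Nat.cast_zero, mul_zero, sub_zero]
      linarith
end
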